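/- A prefix-independent objective W recognized by a deterministic Büchi automaton is half-positional if and only if there exists a set of colors F ⊆ C such that W = Büchi(F), the set of infinite words containing infinitely many letters from F. -/

import Mathlib

/-- Concatenate a finite word in front of an infinite word. -/
def extWord {C : Type} (w : List C) (s : ℕ → C) : ℕ → C :=
  fun n => if h : n < w.length then w.get ⟨n, h⟩ else s (n - w.length)

/-- Winning continuations `w⁻¹W` of a finite word `w` w.r.t. objective `W`. -/
def winCont {C : Type} (W : Set (ℕ → C)) (w : List C) : Set (ℕ → C) :=
  {s | extWord w s ∈ W}

/-- The run of a deterministic automaton from state `q` on infinite word `s`. -/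
def dbaRun {C Q : Type} (δ : Q → C → Q) (q : Q) (s : ℕ → C) : ℕ → Q
  | 0 => q
  | n + 1 => δ (dbaRun δ q s n) (s n)

/-- The set of infinite words accepted (Büchi condition on transitions `acc`) from state `q`. -/
def accFrom {C Q : Type} (δ : Q → C → Q) (acc : Q → C → Prop) (q : Q) : Set (ℕ → C) :=
  {s | ∀ N, ∃ n ≥ N, acc (dbaRun δ q s n) (s n)}

/-- Extension `δ*` of the transition function to finite words. -/
def dstar {C Q : Type} (δ : Q → C → Q) (q : Q) (w : List C) : Q := w.foldl δ q

/-- `Safe(q)`: finite words whose run from `q` takes no Büchi transition. -/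
def safeWords {C Q : Type} (δ : Q → C → Q) (acc : Q → C → Prop) (q : Q) : Set (List C) :=
  {w | ∀ (i : ℕ) (h : i < w.length), ¬ acc (dstar δ q (w.take i)) (w.get ⟨i, h⟩)}

/-- `SafeCycles(q)`: α-free words from `q` that return to `q`. -/
def safeCycles {C Q : Type} (δ : Q → C → Q) (acc : Q → C → Prop) (q : Q) : Set (List C) :=
  {w | w ∈ safeWords δ acc q ∧ dstar δ q w = q}

/-- A DBA is saturated if no strictly larger set of Büchi transitions recognizes the same language. -/
def Saturated {C Q : Type} (δ : Q → C → Q) (acc : Q → C → Prop) (qinit : Q) : Prop :=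
  ∀ acc' : Q → C → Prop, (∀ q c, acc q c → acc' q c) → acc' ≠ acc →
    accFrom δ acc' qinit ≠ accFrom δ acc qinit

/-- Prefix-independence of an objective. -/
def PrefixIndependent {C : Type} (W : Set (ℕ → C)) : Prop :=
  ∀ (w : List C) (s : ℕ → C), s ∈ W ↔ extWord w s ∈ W

/-- The Büchi condition: infinitely many letters in `F`. -/
def BuchiCond {C : Type} (F : Set C) : Set (ℕ → C) :=
  {s | ∀ N, ∃ n ≥ N, s n ∈ F}

/-- DBA-recognizability of an objective. -/
def DBARecognizable {C : Type} (W : Set (ℕ → C)) : Prop :=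
  ∃ (Q : Type) (_ : Fintype Q) (qinit : Q) (δ : Q → C → Q) (acc : Q → C → Prop),
    accFrom δ acc qinit = W

universe u

/-- An infinite play in an arena with edge set `E`. -/
def IsPlay {C : Type} {V : Type u} (E : Set (V × C × V)) (p : ℕ → V) (col : ℕ → C) : Prop :=
  ∀ n, (p n, col n, p (n + 1)) ∈ E

/-- A strategy of Player 1: from a history and the current vertex, choose a colored edge. -/
def Strat (C : Type) (V : Type u) : Type u := List (V × C) → V → C × V

/-- The history (sequence of visited vertices with emitted colors) after `n` steps. -/
def histPref {C : Type} {V : Type u} (p : ℕ → V) (col : ℕ → C) (n : ℕ) : List (V × C) :=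
  (List.range n).map fun i => (p i, col i)

/-- A strategy is valid if it always picks actual edges at Player-1 vertices. -/
def ValidStrat {C : Type} {V : Type u} (E : Set (V × C × V)) (own1 : V → Prop)
    (σ : Strat C V) : Prop :=
  ∀ h v, own1 v → (v, (σ h v).1, (σ h v).2) ∈ E

/-- A play is consistent with strategy `σ` if `σ`'s choices are followed at Player-1 vertices. -/
def ConsistentPlay {C : Type} {V : Type u} (own1 : V → Prop) (σ : Strat C V)
    (p : ℕ → V) (col : ℕ → C) : Prop :=
  ∀ n, own1 (p n) → (col n, p (n + 1)) = σ (histPref p col n) (p n)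

/-- `σ` is winning from `v` for objective `W`. -/
def WinningFrom {C : Type} {V : Type u} (W : Set (ℕ → C)) (E : Set (V × C × V))
    (own1 : V → Prop) (σ : Strat C V) (v : V) : Prop :=
  ∀ p col, IsPlay E p col → p 0 = v → ConsistentPlay own1 σ p col → col ∈ W

/-- A positional strategy only depends on the current vertex. -/
def PositionalStrat {C : Type} {V : Type u} (σ : Strat C V) : Prop :=
  ∀ h h' v, σ h v = σ h' v

/-- Player 1 has a single positional strategy, optimal in the arena `(E, own1)`. -/
def HalfPosArena {C : Type} {V : Type u} (W : Set (ℕ → C)) (E : Set (V × C × V))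
    (own1 : V → Prop) : Prop :=
  ∃ σ : Strat C V, ValidStrat E own1 σ ∧ PositionalStrat σ ∧
    ∀ v, (∃ τ : Strat C V, ValidStrat E own1 τ ∧ WinningFrom W E own1 τ v) →
      WinningFrom W E own1 σ v

/-- Half-positionality over all (non-blocking) arenas of any cardinality. -/
def HalfPositionalAll {C : Type} (W : Set (ℕ → C)) : Prop :=
  ∀ (V : Type u) (E : Set (V × C × V)) (own1 : V → Prop),
    (∀ v, ∃ c v', (v, c, v') ∈ E) → HalfPosArena W E own1

/-- Half-positionality over finite one-player (all vertices to Player 1) arenas. -/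
def HalfPosFinOnePlayer {C : Type} (W : Set (ℕ → C)) : Prop :=
  ∀ (V : Type) [Fintype V] (E : Set (V × C × V)),
    (∀ v, ∃ c v', (v, c, v') ∈ E) → HalfPosArena W E (fun _ => True)

section PrefixIndependence

variable {C : Type} {W : Set (ℕ → C)}

theorem PrefixIndependent.mem_iff_tail (hpi : PrefixIndependent W) (s : ℕ → C) :
    s ∈ W ↔ (fun n => s (n + 1)) ∈ W := by
  have h : extWord [s 0] (fun n => s (n + 1)) = s := by
    funext n
    cases n <;> simp [extWord]
  rw [hpi [s 0] (fun n => s (n + 1)), h]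

theorem PrefixIndependent.mem_iff_shift (hpi : PrefixIndependent W) (s : ℕ → C) (k : ℕ) :
    s ∈ W ↔ (fun n => s (n + k)) ∈ W := by
  induction k with
  | zero => rfl
  | succ k ih =>
    rw [ih, hpi.mem_iff_tail]
    simp only [Nat.add_right_comm, Nat.add_assoc]

end PrefixIndependence

section Automata

variable {C Q : Type} {W : Set (ℕ → C)} {δ : Q → C → Q} {acc : Q → C → Prop}

theorem dbaRun_add (δ : Q → C → Q) (q : Q) (s : ℕ → C) (k n : ℕ) :
    dbaRun δ q s (n + k) = dbaRun δ (dbaRun δ q s k) (fun i => s (i + k)) n := by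
  induction n with
  | zero => simp [dbaRun]
  | succ n ih => rw [Nat.add_right_comm, dbaRun, dbaRun, ih]

theorem dbaRun_congr (δ : Q → C → Q) (q : Q) {s t : ℕ → C} {n : ℕ}
    (h : ∀ i < n, s i = t i) : dbaRun δ q s n = dbaRun δ q t n := by
  induction n with
  | zero => rfl
  | succ n ih =>
    rw [dbaRun, dbaRun, ih fun i hi => h i (hi.trans n.lt_succ_self), h n n.lt_succ_self]

theorem accFrom_dbaRun_one (δ : Q → C → Q) (acc : Q → C → Prop) (q : Q) (s : ℕ → C) :
    s ∈ accFrom δ acc q ↔ (fun n => s (n + 1)) ∈ accFrom δ acc (δ q (s 0)) := by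
  have hrun : ∀ n, dbaRun δ q s (n + 1) = dbaRun δ (δ q (s 0)) (fun i => s (i + 1)) n :=
    fun n => dbaRun_add δ q s 1 n
  constructor
  · intro h N
    obtain ⟨n, hn, ha⟩ := h (N + 1)
    obtain ⟨m, rfl⟩ : ∃ m, n = m + 1 := ⟨n - 1, by omega⟩
    exact ⟨m, by omega, hrun m ▸ ha⟩
  · intro h N
    obtain ⟨n, hn, ha⟩ := h N
    exact ⟨n + 1, by omega, (hrun n).symm ▸ ha⟩

/-- All states reached from the initial one recognize the same prefix-independent objective. -/
theorem PrefixIndependent.accFrom_dbaRun (hpi : PrefixIndependent W) {q : Q}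
    (hq : accFrom δ acc q = W) (s : ℕ → C) (n : ℕ) :
    accFrom δ acc (dbaRun δ q s n) = W := by
  induction n with
  | zero => exact hq
  | succ n ih =>
    ext t
    have h1 := accFrom_dbaRun_one δ acc (dbaRun δ q s n)
      (fun i => Nat.casesOn i (s n) t)
    have h2 := hpi.mem_iff_tail (fun i => Nat.casesOn i (s n) t)
    rw [ih] at h1
    exact h1.symm.trans h2

/-- A letter `c` with `c^ω ∈ W` makes every word containing long enough blocks of `c`
infinitely often belong to `W`. -/
theorem PrefixIndependent.exists_block_bound [Finite Q] (hpi : PrefixIndependent W) {q : Q}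
    (hq : accFrom δ acc q = W) {c : C} (hc : (fun _ => c) ∈ W) :
    ∃ K : ℕ, ∀ s : ℕ → C, (∀ N, ∃ n ≥ N, ∀ i < K, s (i + n) = c) → s ∈ W := by
  have hex : ∀ r : Q, ∃ m : ℕ, accFrom δ acc r = W → acc (dbaRun δ r (fun _ => c) m) c := by
    intro r
    by_cases hr : accFrom δ acc r = W
    · obtain ⟨m, -, hm⟩ := (hr.symm ▸ hc : (fun _ => c) ∈ accFrom δ acc r) 0
      exact ⟨m, fun _ => hm⟩
    · exact ⟨0, fun h => absurd h hr⟩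
  choose m hm using hex
  obtain ⟨B, hB⟩ := (Set.finite_range m).bddAbove
  refine ⟨B + 1, fun s hs => ?_⟩
  rw [← hq]
  intro N
  obtain ⟨n, hn, hblock⟩ := hs N
  set r := dbaRun δ q s n with hr
  have hmB : m r ≤ B := hB ⟨r, rfl⟩
  refine ⟨m r + n, by omega, ?_⟩
  rw [dbaRun_add, hblock _ (by omega), ← hr,
    dbaRun_congr δ r (t := fun _ => c) fun i hi => hblock i (by omega)]
  exact hm r (hpi.accFrom_dbaRun hq s n)

/-- A word outside `W` having infinitely many letters in `F` yields a periodic one that starts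
with a letter of `F`. -/
theorem PrefixIndependent.exists_periodic [Finite Q] (hpi : PrefixIndependent W) {q : Q}
    (hq : accFrom δ acc q = W) {F : Set C} {s : ℕ → C} (hs : s ∉ W) (hF : s ∈ BuchiCond F) :
    ∃ (t : ℕ → C) (n : ℕ), 0 < n ∧ (∀ i, t (i + n) = t i) ∧ t ∉ W ∧ t 0 ∈ F := by
  have hsafe : ∃ N, ∀ n ≥ N, ¬ acc (dbaRun δ q s n) (s n) := by
    by_contra! h
    exact hs (hq ▸ h)
  obtain ⟨N, hN⟩ := hsafe
  have hinf : Infinite {n | N ≤ n ∧ s n ∈ F} := by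
    rw [Set.infinite_coe_iff, Set.infinite_iff_exists_gt]
    intro a
    obtain ⟨n, hn, hnF⟩ := hF (N + a + 1)
    exact ⟨n, ⟨by omega, hnF⟩, by omega⟩
  obtain ⟨x, y, hxy, hrun⟩ := Finite.exists_ne_map_eq_of_infinite
    fun n : {n | N ≤ n ∧ s n ∈ F} => dbaRun δ q s n
  wlog hlt : x < y generalizing x y
  · exact this y x hxy.symm hrun.symm (lt_of_le_of_ne (not_lt.mp hlt) hxy.symm)
  obtain ⟨i, hi, hiF⟩ := x
  obtain ⟨j, hj, hjF⟩ := y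
  replace hlt : i < j := hlt
  simp only at hrun
  refine ⟨fun l => s (i + l % (j - i)), j - i, by omega, fun l => by simp, fun hW => ?_, by simpa⟩
  have hcycle : ∀ l, dbaRun δ (dbaRun δ q s i) (fun l => s (i + l % (j - i))) l =
      dbaRun δ q s (i + l % (j - i)) := by
    intro l
    induction l with
    | zero => simp [dbaRun]
    | succ l ih =>
      rw [dbaRun, ih]
      have hl : l % (j - i) < j - i := Nat.mod_lt _ (by omega)
      rw [← Nat.mod_add_mod l]
      by_cases h : l % (j - i) + 1 = j - i
      · rw [h, Nat.mod_self, Nat.add_zero, hrun, show j = i + l % (j - i) + 1 by omega, dbaRun]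
        simp only [show i + l % (j - i) + 1 = j by omega]
      · rw [Nat.mod_eq_of_lt (a := l % (j - i) + 1) (by omega), ← Nat.add_assoc, dbaRun]
  rw [← hpi.accFrom_dbaRun hq s i] at hW
  obtain ⟨l, -, hl⟩ := hW 0
  rw [hcycle] at hl
  exact hN _ (by omega) hl

end Automata

section OnePlayer

variable {C : Type} {W : Set (ℕ → C)}

theorem length_histPref {V : Type u} (p : ℕ → V) (col : ℕ → C) (n : ℕ) :
    (histPref p col n).length = n := by
  simp [histPref]

/-- If positions of a winning word are identified along `p`, half-positionality allows one to
always follow the same representative `g x` of each class `x`. -/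
theorem HalfPositionalAll.exists_representatives (hW : HalfPositionalAll.{u} W) {s : ℕ → C}
    (hs : s ∈ W) {X : Type} (p : ℕ → X) :
    ∃ g : X → ℕ, (∀ n, p (g (p n)) = p n) ∧
      ∀ v : ℕ → X, v 0 = p 0 → (∀ k, v (k + 1) = p (g (v k) + 1)) →
        (fun k => s (g (v k))) ∈ W := by
  classical
  let E : Set (ULift.{u} X × C × ULift.{u} X) :=
    {e | (∃ n, e = (⟨p n⟩, s n, ⟨p (n + 1)⟩)) ∨ e.1.down ∉ Set.range p}
  have hE : ∀ v, ∃ c v', (v, c, v') ∈ E := by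
    rintro ⟨x⟩
    by_cases hx : x ∈ Set.range p
    · obtain ⟨n, rfl⟩ := hx
      exact ⟨_, _, Or.inl ⟨n, rfl⟩⟩
    · exact ⟨s 0, ⟨x⟩, Or.inr hx⟩
  obtain ⟨σ, hval, hpos, hopt⟩ := hW (ULift.{u} X) E (fun _ => True) hE
  have hwin : WinningFrom W E (fun _ => True) σ ⟨p 0⟩ := by
    choose c v' hcv using hE
    refine hopt _ ⟨fun h v => if v = ⟨p h.length⟩ then (s h.length, ⟨p (h.length + 1)⟩)
      else (c v, v' v), ?_, ?_⟩
    · intro h v _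
      by_cases hv : v = ⟨p h.length⟩
      · simp only [hv, if_true]
        exact Or.inl ⟨_, rfl⟩
      · simp only [hv, if_false]
        exact hcv v
    · intro p' col _ h0 hcons
      have hp : ∀ n, p' n = ⟨p n⟩ := by
        intro n
        induction n with
        | zero => exact h0
        | succ n ih =>
          have h := hcons n trivial
          simp only [length_histPref, ih, if_true, Prod.mk.injEq] at h
          exact h.2
      have hcol : col = s := by
        funext n
        have h := hcons n trivial
        simp only [length_histPref, hp, if_true, Prod.mk.injEq] at h
        exact h.1
      exact hcol ▸ hs
  have hg : ∀ x, ∃ n, x ∈ Set.range p → p n = x ∧ σ [] ⟨x⟩ = (s n, ⟨p (n + 1)⟩) := by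
    intro x
    by_cases hx : x ∈ Set.range p
    · rcases hval [] ⟨x⟩ trivial with ⟨n, hn⟩ | hn
      · simp only [Prod.mk.injEq, ULift.up.injEq] at hn
        exact ⟨n, fun _ => ⟨hn.1.symm, Prod.ext hn.2.1 hn.2.2⟩⟩
      · exact absurd hx hn
    · exact ⟨0, fun h => absurd h hx⟩
  choose g hg using hg
  refine ⟨g, fun n => (hg _ ⟨n, rfl⟩).1, fun v hv0 hv => ?_⟩
  have hrange : ∀ k, v k ∈ Set.range p := by
    rintro (_ | k)
    · exact ⟨0, hv0.symm⟩
    · exact ⟨_, (hv k).symm⟩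
  refine hwin (fun k => ⟨v k⟩) _ (fun k => Or.inl ⟨g (v k), ?_⟩) (by simp [hv0]) fun k _ => ?_
  · simp only [hv k, (hg _ (hrange k)).1]
  · rw [hpos _ []]
    simp only [(hg _ (hrange k)).2, hv k]

theorem HalfPositionalAll.exists_letter (hW : HalfPositionalAll.{u} W) {s : ℕ → C}
    (hs : s ∈ W) : ∃ n, (fun _ => s n) ∈ W := by
  obtain ⟨g, -, hg⟩ := hW.exists_representatives hs (fun _ => ())
  exact ⟨g (), hg (fun _ => ()) rfl fun _ => rfl⟩

/-- If the periodic word `s = (xy)^ω`, with `x` of length `k`, is not in `W`, then neither is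
`(xyyx)^ω`. -/
theorem HalfPositionalAll.double_notMem (hW : HalfPositionalAll.{u} W)
    (hpi : PrefixIndependent W) {s : ℕ → C} {n : ℕ} (hn : 0 < n) (hper : ∀ i, s (i + n) = s i)
    (hs : s ∉ W) (k : ℕ) :
    (fun i => if i % (2 * n) < n then s i else s (i + k)) ∉ W := by
  set t : ℕ → C := fun i => if i % (2 * n) < n then s i else s (i + k) with ht
  intro htW
  have hmod : ∀ i, s (i % n) = s i := fun i => (show Function.Periodic s n from hper).map_mod_nat i
  have ht_mod : ∀ i, t (i % (2 * n)) = t i := by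
    intro i
    have h1 : s (i % (2 * n)) = s i := by
      rw [← hmod, Nat.mod_mul_left_mod, hmod]
    have h2 : s (i % (2 * n) + k) = s (i + k) := by
      rw [← hmod, Nat.add_mod, Nat.mod_mul_left_mod, ← Nat.add_mod, hmod]
    simp only [ht, Nat.mod_mod, h1, h2]
  let p : ℕ → ℕ := fun i => if i % n = 0 then 0 else i % (2 * n)
  obtain ⟨g, hgp, hg⟩ := hW.exists_representatives htW p
  have hp_mod : ∀ i, p (i % (2 * n)) = p i := by
    intro i
    simp only [p, Nat.mod_mul_left_mod, Nat.mod_mod]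
  have hp0 : p 0 = 0 := by simp [p]
  have hp_zero : ∀ i, p i = 0 → i % n = 0 := by
    intro i hi
    by_contra h
    simp only [p, h, if_false] at hi
    rw [← Nat.mod_mul_left_mod i 2 n, hi] at h
    simp at h
  set e := g 0 % (2 * n) with he
  have he_n : e % n = 0 := by
    rw [he, Nat.mod_mul_left_mod]
    exact hp_zero _ (by simpa [hp0] using hgp 0)
  have he_cases : e = 0 ∨ e = n := by
    have hlt : e < 2 * n := Nat.mod_lt _ (by omega)
    obtain ⟨d, hd⟩ := Nat.dvd_of_mod_eq_zero he_n
    have : d < 2 := by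
      by_contra! h
      nlinarith
    interval_cases d
    · left; simpa using hd
    · right; simpa using hd
  have hstep : ∀ j, g (p (e + j % n)) % (2 * n) = e + j % n := by
    intro j
    have hj : j % n < n := Nat.mod_lt _ hn
    have hen : (e + j % n) % n = j % n := by
      rw [Nat.add_mod, he_n, Nat.zero_add, Nat.mod_mod, Nat.mod_mod]
    have hlt : e + j % n < 2 * n := by omega
    by_cases h : j % n = 0
    · have : p (e + j % n) = 0 := by simp [p, h, he_n]
      rw [this, h, Nat.add_zero]
    · have hpe : p (e + j % n) = e + j % n := by
        simp only [p, hen, h, if_false, Nat.mod_eq_of_lt hlt]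
      have h1 := hgp (e + j % n)
      have hne : g (p (e + j % n)) % n ≠ 0 := by
        intro h0
        have : p (g (p (e + j % n))) = 0 := if_pos h0
        omega
      have h2 : p (g (p (e + j % n))) = g (p (e + j % n)) % (2 * n) := if_neg hne
      omega
  have hres := hg (fun j => p (e + j % n)) (by simp [p, he_n]) fun j => by
    have hj : j % n < n := Nat.mod_lt _ hn
    rw [← hp_mod (g _ + 1), ← Nat.mod_add_mod (g _), hstep, hp_mod, ← Nat.mod_add_mod j n 1]
    by_cases h : j % n + 1 = n
    · simp [p, Nat.add_assoc, h, he_n]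
    · rw [Nat.mod_eq_of_lt (a := j % n + 1) (by omega), Nat.add_assoc]
  have hcol : (fun j => t (g (p (e + j % n)))) = fun j => t (e + j % n) := by
    funext j
    rw [← ht_mod, hstep]
  rw [hcol] at hres
  rcases he_cases with h | h
  · have : (fun j => t (e + j % n)) = s := by
      funext j
      have hj : j % n < n := Nat.mod_lt _ hn
      simp only [ht, h, Nat.zero_add, Nat.mod_eq_of_lt (show j % n < 2 * n by omega), hj,
        if_true, hmod]
    exact hs (this ▸ hres)
  · have : (fun j => t (e + j % n)) = fun j => s (j + k) := by
      funext j
      have hj : j % n < n := Nat.mod_lt _ hn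
      simp only [ht, h, Nat.mod_eq_of_lt (show n + j % n < 2 * n by omega)]
      rw [if_neg (by omega), ← hmod, ← hmod (j + k)]
      congr 1
      rw [Nat.add_assoc, Nat.add_mod_left, Nat.mod_add_mod]
    rw [this, ← hpi.mem_iff_shift] at hres
    exact hs hres

theorem HalfPositionalAll.exists_long_block (hW : HalfPositionalAll.{u} W)
    (hpi : PrefixIndependent W) {s : ℕ → C} {n : ℕ} (hn : 0 < n) (hper : ∀ i, s (i + n) = s i)
    (hs : s ∉ W) (k : ℕ) :
    ∃ (t : ℕ → C) (m : ℕ), 2 ^ k ≤ m ∧ (∀ i, t (i + m) = t i) ∧ t ∉ W ∧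
      ∀ i < 2 ^ k, t i = s 0 := by
  induction k with
  | zero =>
    refine ⟨s, n, hn, hper, hs, fun i hi => ?_⟩
    obtain rfl : i = 0 := by simpa using hi
    rfl
  | succ k ih =>
    obtain ⟨t, m, hm, htper, htW, ht⟩ := ih
    have hpow : 0 < 2 ^ k := by positivity
    have hdouble := hW.double_notMem hpi (by omega) htper htW (2 ^ k)
    rw [hpi.mem_iff_shift _ (2 * m - 2 ^ k)] at hdouble
    have htper2 : ∀ i, t (i + 2 * m) = t i := fun i => by
      rw [two_mul, ← Nat.add_assoc, htper, htper]
    refine ⟨_, 2 * m, by rw [pow_succ]; omega, fun i => ?_, hdouble, fun i hi => ?_⟩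
    · have h1 : i + 2 * m + (2 * m - 2 ^ k) = i + (2 * m - 2 ^ k) + 2 * m := by omega
      have h2 : i + (2 * m - 2 ^ k) + 2 * m + 2 ^ k = i + (2 * m - 2 ^ k) + 2 ^ k + 2 * m := by
        omega
      simp only [h1, h2, Nat.add_mod_right, htper2]
    · rw [pow_succ] at hi
      by_cases hik : i < 2 ^ k
      · have h1 : (i + (2 * m - 2 ^ k)) % (2 * m) = i + (2 * m - 2 ^ k) :=
          Nat.mod_eq_of_lt (by omega)
        have h2 : i + (2 * m - 2 ^ k) + 2 ^ k = i + 2 * m := by omega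
        simp only [h1]
        rw [if_neg (by omega), h2, htper2, ht i hik]
      · have h1 : i + (2 * m - 2 ^ k) = i - 2 ^ k + 2 * m := by omega
        simp only [h1, Nat.add_mod_right]
        rw [if_pos (by rw [Nat.mod_eq_of_lt] <;> omega), htper2, ht _ (by omega)]

end OnePlayer

theorem HalfPositionalAll.eq_buchiCond {C : Type} {W : Set (ℕ → C)}
    (hW : HalfPositionalAll.{u} W) (hpi : PrefixIndependent W) (hdba : DBARecognizable W) :
    W = BuchiCond {c | (fun _ => c) ∈ W} := by
  ext s
  constructor
  · intro hs N
    rw [hpi.mem_iff_shift s N] at hs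
    obtain ⟨n, hn⟩ := hW.exists_letter hs
    exact ⟨n + N, by omega, hn⟩
  · intro hF
    by_contra hs
    obtain ⟨Q, _, q, δ, acc, hq⟩ := hdba
    obtain ⟨t, n, hn, hper, ht, ht0⟩ := hpi.exists_periodic hq hs hF
    obtain ⟨K, hK⟩ := hpi.exists_block_bound hq ht0
    obtain ⟨u, m, hm, huper, hu, hblock⟩ := hW.exists_long_block hpi hn hper ht K
    have hKm : K < 2 ^ K := Nat.lt_two_pow_self
    refine hu (hK u fun N => ⟨N * m, Nat.le_mul_of_pos_right N (by omega), fun i hi => ?_⟩)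
    exact ((show Function.Periodic u m from huper).nat_mul N i).trans (hblock i (by omega))

section BuchiGames

variable {C : Type} {V : Type u} {W : Set (ℕ → C)} {E : Set (V × C × V)} {own1 : V → Prop}

theorem histPref_succ (p : ℕ → V) (col : ℕ → C) (n : ℕ) :
    histPref p col (n + 1) =
      (p 0, col 0) :: histPref (fun i => p (i + 1)) (fun i => col (i + 1)) n := by
  simp [histPref, List.range_succ_eq_map, Function.comp_def]

/-- The vertices from which Player 1 has a winning strategy. -/
def WinRegion (W : Set (ℕ → C)) (E : Set (V × C × V)) (own1 : V → Prop) : Set V :=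
  {v | ∃ τ : Strat C V, ValidStrat E own1 τ ∧ WinningFrom W E own1 τ v}

/-- The strategy that remains to be played once the edge from `v` colored `c` was taken. -/
def Strat.residual (τ : Strat C V) (v : V) (c : C) : Strat C V :=
  fun h w => τ ((v, c) :: h) w

theorem WinningFrom.residual (hpi : PrefixIndependent W) {τ : Strat C V} {v v' : V} {c : C}
    (hτ : WinningFrom W E own1 τ v) (he : (v, c, v') ∈ E)
    (hc : own1 v → (c, v') = τ [] v) : WinningFrom W E own1 (τ.residual v c) v' := by
  intro p col hplay h0 hcons
  have key := hτ (fun n => Nat.casesOn n v p) (fun n => Nat.casesOn n c col) ?_ rfl ?_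
  · exact (hpi.mem_iff_tail _).mp key
  · rintro (_ | n)
    · simpa [h0] using he
    · exact hplay n
  · rintro (_ | n) hn
    · simpa [h0, histPref] using hc hn
    · rw [histPref_succ]
      exact hcons n hn

theorem winRegion_of_own1 (hpi : PrefixIndependent W) {v : V} (hv : v ∈ WinRegion W E own1)
    (ho : ¬ own1 v) {c : C} {v' : V} (he : (v, c, v') ∈ E) : v' ∈ WinRegion W E own1 := by
  obtain ⟨τ, hval, hwin⟩ := hv
  exact ⟨τ.residual v c, fun h w hw => hval _ w hw,
    hwin.residual hpi he fun h => absurd h ho⟩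

/-- `Forces E own1 F R o v`: from `v`, Player 1 can force in at most `o` steps a color of `F`
to be seen, with own moves staying in `R`. -/
def Forces (E : Set (V × C × V)) (own1 : V → Prop) (F : Set C) (R : Set V)
    (o : Ordinal.{u}) (v : V) : Prop :=
  (own1 v → ∃ c v', (v, c, v') ∈ E ∧ v' ∈ R ∧
    (c ∈ F ∨ ∃ o', ∃ _ : o' < o, Forces E own1 F R o' v')) ∧
  (¬ own1 v → ∀ c v', (v, c, v') ∈ E →
    (c ∈ F ∨ ∃ o', ∃ _ : o' < o, Forces E own1 F R o' v'))
termination_by o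

theorem exists_forces_of_opponent {F : Set C} {R : Set V} {v : V} (ho : ¬ own1 v)
    (h : ∀ c v', (v, c, v') ∈ E → c ∈ F ∨ ∃ o, Forces E own1 F R o v') :
    ∃ o, Forces E own1 F R o v := by
  classical
  have hex : ∀ v', ∃ o, (∃ o, Forces E own1 F R o v') → Forces E own1 F R o v' := by
    intro v'
    by_cases hv' : ∃ o, Forces E own1 F R o v'
    · exact ⟨hv'.choose, fun _ => hv'.choose_spec⟩
    · exact ⟨0, fun h => absurd h hv'⟩
  choose f hf using hex
  refine ⟨Order.succ (⨆ v', f v'), ?_⟩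
  rw [Forces]
  refine ⟨fun h => absurd h ho, fun _ c v' he => ?_⟩
  exact (h c v' he).imp_right fun hv' =>
    ⟨f v', Order.lt_succ_of_le (Ordinal.le_iSup f v'), hf v' hv'⟩

theorem exists_forces_of_own1 {F : Set C} {R : Set V} {v v' : V} {c : C} (ho : own1 v)
    (he : (v, c, v') ∈ E) (hv' : v' ∈ R) (h : c ∈ F ∨ ∃ o, Forces E own1 F R o v') :
    ∃ o, Forces E own1 F R o v := by
  rcases h with hc | ⟨o, h⟩
  · refine ⟨0, ?_⟩
    rw [Forces]
    exact ⟨fun _ => ⟨c, v', he, hv', Or.inl hc⟩, fun h => absurd ho h⟩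
  · refine ⟨Order.succ o, ?_⟩
    rw [Forces]
    exact ⟨fun _ => ⟨c, v', he, hv', Or.inr ⟨o, Order.lt_succ o, h⟩⟩, fun h => absurd ho h⟩

theorem prefixIndependent_buchiCond (F : Set C) : PrefixIndependent (BuchiCond F) := by
  intro w s
  have hext : ∀ n, extWord w s (n + w.length) = s n := fun n => by simp [extWord]
  constructor
  · intro h N
    obtain ⟨n, hn, hF⟩ := h N
    exact ⟨n + w.length, by omega, (hext n).symm ▸ hF⟩
  · intro h N
    obtain ⟨n, hn, hF⟩ := h (N + w.length)
    refine ⟨n - w.length, by omega, ?_⟩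
    rwa [← hext, Nat.sub_add_cancel (by omega)]

theorem exists_forces_of_mem_winRegion {F : Set C} {v : V}
    (hv : v ∈ WinRegion (BuchiCond F) E own1) :
    ∃ o, Forces E own1 F (WinRegion (BuchiCond F) E own1) o v := by
  set R := WinRegion (BuchiCond F) E own1 with hR
  by_contra hnot
  let S := {x : Strat C V × V //
    (ValidStrat E own1 x.1 ∧ WinningFrom (BuchiCond F) E own1 x.1 x.2) ∧
    ¬ ∃ o, Forces E own1 F R o x.2}
  have hpi := prefixIndependent_buchiCond F
  have hstep : ∀ x : S, ∃ (c : C) (y : S), (x.1.2, c, y.1.2) ∈ E ∧ c ∉ F ∧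
      y.1.1 = x.1.1.residual x.1.2 c ∧ (own1 x.1.2 → (c, y.1.2) = x.1.1 [] x.1.2) := by
    rintro ⟨⟨τ, w⟩, ⟨hval, hwin⟩, hw⟩
    simp only at hval hwin hw
    have hmove : ∃ c w', (w, c, w') ∈ E ∧ (own1 w → (c, w') = τ [] w) ∧ c ∉ F ∧
        ¬ ∃ o, Forces E own1 F R o w' := by
      by_cases ho : own1 w
      · have he := hval [] w ho
        have hw' : (τ [] w).2 ∈ R := ⟨τ.residual w (τ [] w).1, fun h w hw => hval _ w hw,
          hwin.residual hpi he fun _ => rfl⟩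
        have := mt (exists_forces_of_own1 ho he hw') hw
        exact ⟨_, _, he, fun _ => rfl, not_or.mp this⟩
      · have := mt (exists_forces_of_opponent ho) hw
        push Not at this
        obtain ⟨c, w', he, hc, hw'⟩ := this
        exact ⟨c, w', he, fun h => absurd h ho, hc, fun ⟨o, h⟩ => hw' o h⟩
    obtain ⟨c, w', he, hc, hcF, hw'⟩ := hmove
    exact ⟨c, ⟨(τ.residual w c, w'), ⟨fun h w hw => hval _ w hw, hwin.residual hpi he hc⟩, hw'⟩,
      he, hcF, rfl, hc⟩
  choose c next hedge hcF hres hcons using hstep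
  obtain ⟨τ, hval, hwin⟩ := hv
  let x : ℕ → S := fun n => next^[n] ⟨(τ, v), ⟨hval, hwin⟩, hnot⟩
  have hx : ∀ n, x (n + 1) = next (x n) := fun n => Function.iterate_succ_apply' _ _ _
  have hstrat : ∀ n h w,
      (x n).1.1 h w = τ (histPref (fun i => (x i).1.2) (fun i => c (x i)) n ++ h) w := by
    intro n
    induction n with
    | zero => intro h w; rfl
    | succ n ih =>
      intro h w
      rw [hx, hres, Strat.residual, ih]
      simp [histPref, List.range_succ]
  have hmem := hwin (fun n => (x n).1.2) (fun n => c (x n))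
    (fun n => by simpa only [hx] using hedge (x n)) rfl fun n ho => by
      have h1 := hcons (x n) ho
      rw [hstrat, List.append_nil, ← hx] at h1
      exact h1
  obtain ⟨n, -, hn⟩ := hmem 0
  exact hcF _ hn

/-- The winning region of a Büchi game carries a rank that Player 1 can force to decrease
until a color of `F` is seen. -/
theorem exists_rank (F : Set C) :
    ∃ rank : V → Ordinal.{u}, ∀ v ∈ WinRegion (BuchiCond F) E own1,
      (own1 v → ∃ e : C × V, (v, e.1, e.2) ∈ E ∧ e.2 ∈ WinRegion (BuchiCond F) E own1 ∧
        (e.1 ∈ F ∨ rank e.2 < rank v)) ∧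
      (¬ own1 v → ∀ c v', (v, c, v') ∈ E → v' ∈ WinRegion (BuchiCond F) E own1 ∧
        (c ∈ F ∨ rank v' < rank v)) := by
  set R := WinRegion (BuchiCond F) E own1 with hR
  refine ⟨fun v => sInf {o | Forces E own1 F R o v}, fun v hv => ?_⟩
  have hmin : Forces E own1 F R (sInf {o | Forces E own1 F R o v}) v :=
    csInf_mem (exists_forces_of_mem_winRegion hv)
  rw [Forces] at hmin
  have hlt : ∀ {v'}, (∃ o', ∃ _ : o' < sInf {o | Forces E own1 F R o v},
      Forces E own1 F R o' v') →
      sInf {o | Forces E own1 F R o v'} < sInf {o | Forces E own1 F R o v} := by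
    rintro v' ⟨o', ho', h⟩
    exact (csInf_le' (show o' ∈ {o | Forces E own1 F R o v'} from h)).trans_lt ho'
  refine ⟨fun ho => ?_, fun ho c v' he => ⟨?_, (hmin.2 ho c v' he).imp_right hlt⟩⟩
  · obtain ⟨c, v', he, hv', h⟩ := hmin.1 ho
    exact ⟨(c, v'), he, hv', h.imp_right hlt⟩
  · exact winRegion_of_own1 (prefixIndependent_buchiCond F) hv ho he

theorem halfPositionalAll_buchiCond (F : Set C) : HalfPositionalAll.{u} (BuchiCond F) := by
  intro V E own1 hE
  obtain ⟨rank, hrank⟩ := exists_rank (E := E) (own1 := own1) F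
  have hmove : ∀ v, ∃ e : C × V, (v, e.1, e.2) ∈ E ∧
      (v ∈ WinRegion (BuchiCond F) E own1 → own1 v →
        e.2 ∈ WinRegion (BuchiCond F) E own1 ∧ (e.1 ∈ F ∨ rank e.2 < rank v)) := by
    intro v
    by_cases h : v ∈ WinRegion (BuchiCond F) E own1 ∧ own1 v
    · obtain ⟨e, he, h'⟩ := (hrank v h.1).1 h.2
      exact ⟨e, he, fun _ _ => h'⟩
    · obtain ⟨c, v', he⟩ := hE v
      exact ⟨(c, v'), he, fun h1 h2 => absurd ⟨h1, h2⟩ h⟩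
  choose f hfE hf using hmove
  refine ⟨fun _ v => f v, fun _ v _ => hfE v, fun _ _ _ => rfl, fun v hv => ?_⟩
  intro p col hplay h0 hcons
  have hprogress : ∀ n, p n ∈ WinRegion (BuchiCond F) E own1 →
      p (n + 1) ∈ WinRegion (BuchiCond F) E own1 ∧
        (col n ∈ F ∨ rank (p (n + 1)) < rank (p n)) := by
    intro n hn
    by_cases ho : own1 (p n)
    · have h := hf _ hn ho
      rwa [← show (col n, p (n + 1)) = f (p n) from hcons n ho] at h
    · exact (hrank _ hn).2 ho _ _ (hplay n)
  have hregion : ∀ n, p n ∈ WinRegion (BuchiCond F) E own1 := by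
    intro n
    induction n with
    | zero => rw [h0]; exact hv
    | succ n ih => exact (hprogress n ih).1
  intro N
  by_contra! hN
  obtain ⟨n, hn⟩ := WellFounded.not_rel_apply_succ
    (r := ((· < ·) : Ordinal.{u} → Ordinal.{u} → Prop)) (fun n => rank (p (n + N)))
  refine hn ?_
  rw [Nat.add_right_comm]
  exact (hprogress _ (hregion _)).2.resolve_left (hN _ (by omega))

end BuchiGames

/-- a prefix-independent DBA-recognizable objective is half-positional iff
it is a Büchi condition `Büchi(F)` for some set of colors `F`. -/
theorem stmt10 {C : Type} (W : Set (ℕ → C))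
    (hpi : PrefixIndependent W) (hdba : DBARecognizable W) :
    HalfPositionalAll.{u} W ↔ ∃ F : Set C, W = BuchiCond F := by
  constructor
  · exact fun hW => ⟨_, hW.eq_buchiCond hpi hdba⟩
  · rintro ⟨F, rfl⟩
    exact halfPositionalAll_buchiCond F
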